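/- arXiv:2506.16086 — 8 statements merged into one kernel-verified Lean document; each statement's English description precedes it below -/
import Mathlib

section
/- Let X, Y, Z be schemes, and let f : X ⟶ Y and g : Y ⟶ Z be morphisms of schemes. If g is unramified (locally of finite type with formally unramified local rings, equivalently with open immersion diagonal) and the composition g ∘ f is smooth, then f is smooth. -/
open CategoryTheory CategoryTheory.Limits AlgebraicGeometry

/-- A morphism of schemes is unramified if it is locally of finite type and its
diagonal morphism is an open immersion. -/
def AlgebraicGeometry.IsUnramifiedMorphism {X Y : Scheme} (g : X ⟶ Y) : Prop :=
  LocallyOfFiniteType g ∧ IsOpenImmersion (pullback.diagonal g)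

/-- Lemma `unramifiedtosmooth`: if `g : Y ⟶ Z` is unramified and `f ≫ g : X ⟶ Z` is
smooth, then `f : X ⟶ Y` is smooth. -/
theorem AlgebraicGeometry.isSmooth_of_comp_isSmooth_of_isUnramified
    {X Y Z : Scheme} (f : X ⟶ Y) (g : Y ⟶ Z)
    (hg : IsUnramifiedMorphism g) (hfg : IsSmooth (f ≫ g)) : IsSmooth f := by
  have : MorphismProperty.IsMultiplicative @Smooth := { id_mem _ := inferInstanceAs (Smooth (𝟙 _)) }
  have : MorphismProperty.HasOfPostcompProperty @Smooth
      (MorphismProperty.diagonal @IsOpenImmersion) :=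
    MorphismProperty.hasOfPostcompProperty_iff_le_diagonal.mpr
      fun _ _ h (_ : IsOpenImmersion (pullback.diagonal h)) ↦
        inferInstanceAs (Smooth (pullback.diagonal h))
  exact MorphismProperty.of_postcomp (W := @Smooth)
    (W' := MorphismProperty.diagonal @IsOpenImmersion) f g hg.2 hfg
end

section
/- There exists a nonempty subset K ⊆ I = (ℤ/nℤ) \ {0̄, r̄} whose image under translation by s̄ equals K, if and only if gcd(r, s) ≥ 2. Equivalently, the largest subset of I stable under l ↦ l + s̄ is empty if and only if gcd(r, s) = 1. -/
/-- A subset of `ZMod n` stable under translation by a unit is empty once it misses `0`. -/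
theorem ZMod.eq_empty_of_image_add_unit_eq {n : ℕ} [NeZero n] {s : ZMod n} (hs : IsUnit s)
    {K : Set (ZMod n)} (hK : (fun l => l + s) '' K = K) (h0 : (0 : ZMod n) ∉ K) : K = ∅ := by
  refine Set.eq_empty_of_forall_notMem fun x hx => h0 ?_
  have step (k : ℕ) : x + k * s ∈ K := by
    induction k with
    | zero => simpa using hx
    | succ k ih =>
      have h : x + k * s + s ∈ K := hK ▸ Set.mem_image_of_mem (fun l => l + s) ih
      simpa [add_mul, add_assoc] using h
  obtain ⟨u, rfl⟩ := hs
  simpa using step (-x * ↑u⁻¹ : ZMod n).val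

/-- For `d` dividing `n` and `s`, the residues modulo `n` that are nonzero modulo `d` are stable
under translation by `s`. -/
theorem ZMod.image_add_setOf_castHom_ne_zero {n d s : ℕ} (hn : d ∣ n) (hs : d ∣ s) :
    (fun l => l + (s : ZMod n)) '' {l | ZMod.castHom hn (ZMod d) l ≠ 0} =
      {l | ZMod.castHom hn (ZMod d) l ≠ 0} := by
  have hs0 : (s : ZMod d) = 0 := (ZMod.natCast_eq_zero_iff s d).2 hs
  ext l
  constructor
  · rintro ⟨k, hk, rfl⟩
    simpa only [Set.mem_ofPred_eq, map_add, map_natCast, hs0, add_zero] using hk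
  · intro hl
    refine ⟨l - s, ?_, sub_add_cancel _ _⟩
    simpa only [Set.mem_ofPred_eq, map_sub, map_natCast, hs0, sub_zero] using hl


/-- Corollary of §5.2.1 of the paper: there is a nonempty subset of
`I = (ℤ/nℤ) \ {0, r}` stable under `l ↦ l + s` iff `gcd(r,s) ≥ 2`; equivalently, the
largest such subset is empty iff `gcd(r,s) = 1`. -/
theorem gln_canonical_parabolic_of_identity_is_borel_iff (r s : ℕ)
    (hr : 1 ≤ r) (hs : 1 ≤ s) :
    let n : ℕ := r + s
    let I : Set (ZMod n) := {l | l ≠ 0 ∧ l ≠ (r : ZMod n)}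
    ((∃ K : Set (ZMod n), K.Nonempty ∧ K ⊆ I ∧ (fun l => l + (s : ZMod n)) '' K = K) ↔
      2 ≤ Nat.gcd r s) ∧
    ((⋃₀ {K : Set (ZMod n) | K ⊆ I ∧ (fun l => l + (s : ZMod n)) '' K = K} = ∅) ↔
      Nat.gcd r s = 1) := by
  intro n I
  have : NeZero n := ⟨by omega⟩
  have hpos : 0 < Nat.gcd r s := Nat.gcd_pos_of_pos_left s hr
  have key : (∃ K : Set (ZMod n), K.Nonempty ∧ K ⊆ I ∧ (fun l => l + (s : ZMod n)) '' K = K) ↔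
      2 ≤ Nat.gcd r s := by
    constructor
    · rintro ⟨K, hne, hKI, hK⟩
      by_contra hlt
      have hcop : Nat.Coprime s n := by
        rw [Nat.coprime_add_self_right, Nat.coprime_comm, Nat.Coprime]
        omega
      exact hne.ne_empty (ZMod.eq_empty_of_image_add_unit_eq
        ((ZMod.isUnit_iff_coprime s n).2 hcop) hK fun h => (hKI h).1 rfl)
    · intro h
      have : Fact (1 < Nat.gcd r s) := ⟨h⟩
      have hdr := Nat.gcd_dvd_left r s
      have hds := Nat.gcd_dvd_right r s
      have hdn : Nat.gcd r s ∣ n := Nat.dvd_add hdr hds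
      refine ⟨{l | ZMod.castHom hdn (ZMod (Nat.gcd r s)) l ≠ 0}, ⟨1, ?_⟩, fun l hl => ⟨?_, ?_⟩,
        ZMod.image_add_setOf_castHom_ne_zero hdn hds⟩
      · rw [Set.mem_ofPred_eq, map_one]
        exact one_ne_zero
      · rintro rfl
        exact hl (map_zero _)
      · rintro rfl
        exact hl ((map_natCast _ r).trans ((ZMod.natCast_eq_zero_iff _ _).2 hdr))
  refine ⟨key, ?_⟩
  have hunion : ⋃₀ {K : Set (ZMod n) | K ⊆ I ∧ (fun l => l + (s : ZMod n)) '' K = K} = ∅ ↔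
      ¬ 2 ≤ Nat.gcd r s := by
    rw [← key, Set.sUnion_eq_empty]
    push Not
    exact ⟨fun h K hne hKI hK => hne.ne_empty (h K ⟨hKI, hK⟩),
      fun h K hK => Set.not_nonempty_iff_eq_empty.1 fun hne => h K hne hK.1 hK.2⟩
  rw [hunion]
  omega
end

section
/- Let T := {r̄ − s̄ − 1̄, r̄ − s̄, r̄ − s̄ + 1̄} ⊆ ℤ/nℤ and C' := {l ∈ ℤ/nℤ : l ∉ H, l − 1̄ ∉ H, l + 1̄ ∉ H}. Then: (a) C' ⊆ I; (b) the image of C' under translation by s̄ equals C'; (c) C' ∩ T = ∅; and (d) every subset K ⊆ I with image under translation by s̄ equal to K and with K ∩ T = ∅ satisfies K ⊆ C'. In other words, C' is the largest subset of I stable under l ↦ l + s̄ and disjoint from T. -/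
/-- A set stable under translation by `g` is stable under translation by every multiple of `g`. -/
theorem Set.add_mem_of_image_add_right_eq_self {G : Type*} [AddGroup G] {K : Set G} {g : G}
    (hK : (fun l => l + g) '' K = K) {l h : G} (hh : h ∈ AddSubgroup.zmultiples g) (hl : l ∈ K) :
    l + h ∈ K := by
  have hadd : ∀ x ∈ K, x + g ∈ K := fun x hx => hK ▸ Set.mem_image_of_mem _ hx
  have hsub : ∀ x ∈ K, x + -g ∈ K := by
    intro x hx
    rw [← hK] at hx
    obtain ⟨y, hy, rfl⟩ := hx
    simpa using hy
  obtain ⟨k, rfl⟩ := AddSubgroup.mem_zmultiples_iff.mp hh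
  induction k with
  | zero => simpa using hl
  | succ k ih =>
    rw [add_zsmul, one_zsmul, ← add_assoc]
    exact hadd _ (ih ⟨_, rfl⟩)
  | pred k ih =>
    rw [sub_zsmul, one_zsmul, ← add_assoc]
    exact hsub _ (ih ⟨_, rfl⟩)

theorem ZMod.natCast_eq_neg_natCast_of_add (r s : ℕ) :
    (r : ZMod (r + s)) = -(s : ZMod (r + s)) := by
  rw [eq_neg_iff_add_eq_zero, ← Nat.cast_add, ZMod.natCast_self]

theorem ZMod.zmultiples_gcd_eq_zmultiples (r s : ℕ) :
    AddSubgroup.zmultiples ((Nat.gcd r s : ℕ) : ZMod (r + s)) =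
      AddSubgroup.zmultiples (s : ZMod (r + s)) := by
  apply le_antisymm <;> rw [AddSubgroup.zmultiples_le, AddSubgroup.mem_zmultiples_iff]
  · refine ⟨Nat.gcdB r s - Nat.gcdA r s, ?_⟩
    have h := congrArg (Int.cast : ℤ → ZMod (r + s)) (Nat.gcd_eq_gcd_ab r s)
    push_cast at h
    rw [h, zsmul_eq_mul, ZMod.natCast_eq_neg_natCast_of_add r s]
    push_cast
    ring
  · obtain ⟨k, hk⟩ := Nat.gcd_dvd_right r s
    refine ⟨k, ?_⟩
    rw [zsmul_eq_mul, Int.cast_natCast, mul_comm, ← Nat.cast_mul, ← hk]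


/-- §5.2.1 of the paper: the largest subset of `I = (ℤ/nℤ) \ {0, r}` stable under
`l ↦ l + s` and disjoint from `T = {r-s-1, r-s, r-s+1}` is
`C' = {l | l ∉ H, l - 1 ∉ H, l + 1 ∉ H}`, where `H` is generated by `gcd r s`. -/
theorem gln_type_of_canonical_parabolic_of_length_one (r s : ℕ) (hr : 1 ≤ r) (hs : 1 ≤ s) :
    let n : ℕ := r + s
    let H : AddSubgroup (ZMod n) := AddSubgroup.zmultiples ((Nat.gcd r s : ℕ) : ZMod n)
    let I : Set (ZMod n) := {l | l ≠ 0 ∧ l ≠ (r : ZMod n)}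
    let T : Set (ZMod n) :=
      {(r : ZMod n) - (s : ZMod n) - 1, (r : ZMod n) - (s : ZMod n),
        (r : ZMod n) - (s : ZMod n) + 1}
    let C' : Set (ZMod n) := {l | l ∉ H ∧ l - 1 ∉ H ∧ l + 1 ∉ H}
    C' ⊆ I ∧
    (fun l => l + (s : ZMod n)) '' C' = C' ∧
    C' ∩ T = ∅ ∧
    (∀ K : Set (ZMod n), K ⊆ I → (fun l => l + (s : ZMod n)) '' K = K → K ∩ T = ∅ →
      K ⊆ C') := by
  intro n H I T C'
  have hH : H = AddSubgroup.zmultiples (s : ZMod n) := ZMod.zmultiples_gcd_eq_zmultiples r s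
  have hsH : (s : ZMod n) ∈ H := hH ▸ AddSubgroup.mem_zmultiples _
  have hrH : (r : ZMod n) ∈ H := by
    rw [show (r : ZMod n) = -s from ZMod.natCast_eq_neg_natCast_of_add r s]
    exact H.neg_mem hsH
  have hrsH : (r : ZMod n) - s ∈ H := H.sub_mem hrH hsH
  have hC : ∀ l h : ZMod n, h ∈ H → l ∈ C' → l + h ∈ C' := by
    rintro l h hh ⟨h0, h1, h2⟩
    refine ⟨?_, ?_, ?_⟩
    · rwa [H.add_mem_cancel_right hh]
    · rwa [add_sub_right_comm, H.add_mem_cancel_right hh]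
    · rwa [add_right_comm, H.add_mem_cancel_right hh]
  refine ⟨?_, ?_, ?_, ?_⟩
  · rintro l ⟨hl, -, -⟩
    exact ⟨fun h => hl (h ▸ H.zero_mem), fun h => hl (h ▸ hrH)⟩
  · refine Set.Subset.antisymm ?_ fun l hl => ⟨l + -s, hC l _ (H.neg_mem hsH) hl, by simp⟩
    rintro _ ⟨l, hl, rfl⟩
    exact hC l _ hsH hl
  · refine Set.eq_empty_of_forall_notMem ?_
    rintro l ⟨⟨h0, h1, h2⟩, rfl | rfl | rfl⟩
    · exact h2 (by rwa [sub_add_cancel])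
    · exact h0 hrsH
    · exact h1 (by rwa [add_sub_cancel_right])
  · intro K _ hK hKT l hl
    have hmem : ∀ m, m - l ∈ H → m ∈ K := fun m hm =>
      add_sub_cancel l m ▸ Set.add_mem_of_image_add_right_eq_self hK (hH ▸ hm) hl
    have hT : ∀ m ∈ T, m ∉ K := fun m hm hmK => Set.eq_empty_iff_forall_notMem.mp hKT m ⟨hmK, hm⟩
    refine ⟨fun h => ?_, fun h => ?_, fun h => ?_⟩
    · exact hT _ (Or.inr (Or.inl rfl)) (hmem _ (H.sub_mem hrsH h))
    · refine hT _ (Or.inr (Or.inr rfl)) (hmem _ ?_)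
      convert H.sub_mem hrsH h using 1
      ring
    · refine hT _ (Or.inl rfl) (hmem _ ?_)
      convert H.sub_mem hrsH h using 1
      ring
end

section
/- Let T := {r̄ − s̄ − 1̄, r̄ − s̄, r̄ − s̄ + 1̄} ⊆ ℤ/nℤ. The largest subset of I = (ℤ/nℤ) \ {0̄, r̄} stable under translation by s̄ (that is, the union of all K ⊆ I with image under l ↦ l + s̄ equal to K) coincides with the largest subset of I that is stable under translation by s̄ and disjoint from T, if and only if gcd(r, s) = 1 (in which case both sets are empty). -/
/-- A set in `ZMod n` that is invariant under translation by an integer coprime to `n` contains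
`0` as soon as it is nonempty. -/
theorem ZMod.zero_mem_of_image_add_natCast_eq {n s : ℕ} [NeZero n] (h : s.Coprime n)
    {K : Set (ZMod n)} (hK : (fun l => l + (s : ZMod n)) '' K = K) (hne : K.Nonempty) :
    (0 : ZMod n) ∈ K := by
  obtain ⟨x, hx⟩ := hne
  have h_iter : ∀ k : ℕ, x + k * (s : ZMod n) ∈ K := by
    intro k
    induction k with
    | zero => simpa using hx
    | succ k ih =>
      rw [← hK]
      exact ⟨_, ih, by push_cast; ring⟩
  convert h_iter (-x * (s : ZMod n)⁻¹).val using 1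
  rw [ZMod.natCast_zmod_val]
  linear_combination x * ZMod.coe_mul_inv_eq_one s h

/-- The complement of the kernel of a ring homomorphism is invariant under translation by any
element of the kernel. -/
theorem RingHom.image_add_setOf_ne_zero {R S : Type*} [Ring R] [Ring S] (f : R →+* S) {a : R}
    (ha : f a = 0) : (fun l => l + a) '' {l | f l ≠ 0} = {l | f l ≠ 0} := by
  ext l
  constructor
  · rintro ⟨m, hm, rfl⟩
    simpa [ha] using hm
  · intro hl
    exact ⟨l - a, by simpa [ha] using hl, by simp⟩

/-- Theorem `thm-len1gln` (combinatorial core): the largest subset of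
`I = (ℤ/nℤ) \ {0, r}` stable under `l ↦ l + s` coincides with the largest subset of `I`
stable under `l ↦ l + s` and disjoint from `T = {r-s-1, r-s, r-s+1}` iff
`gcd(r,s) = 1`, in which case both sets are empty. -/
theorem glm_length_one_stratum_smooth_iff (r s : ℕ) (hr : 1 ≤ r) (hs : 1 ≤ s) :
    let n : ℕ := r + s
    let I : Set (ZMod n) := {l | l ≠ 0 ∧ l ≠ (r : ZMod n)}
    let T : Set (ZMod n) :=
      {(r : ZMod n) - (s : ZMod n) - 1, (r : ZMod n) - (s : ZMod n),
        (r : ZMod n) - (s : ZMod n) + 1}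
    let A : Set (ZMod n) :=
      ⋃₀ {K : Set (ZMod n) | K ⊆ I ∧ (fun l => l + (s : ZMod n)) '' K = K}
    let B : Set (ZMod n) :=
      ⋃₀ {K : Set (ZMod n) | K ⊆ I ∧ (fun l => l + (s : ZMod n)) '' K = K ∧ K ∩ T = ∅}
    ((A = B) ↔ Nat.gcd r s = 1) ∧ (Nat.gcd r s = 1 → A = ∅ ∧ B = ∅) := by
  intro n I T A B
  have hn : NeZero n := ⟨by omega⟩
  have h_empty : Nat.gcd r s = 1 → A = ∅ ∧ B = ∅ := by
    intro h
    have h_cop : s.Coprime n := by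
      simpa [n] using (Nat.Coprime.symm h : s.Coprime r)
    have h_stable : ∀ K : Set (ZMod n), K ⊆ I → (fun l => l + (s : ZMod n)) '' K = K → K = ∅ := by
      intro K hKI hK
      by_contra hne
      exact (hKI (ZMod.zero_mem_of_image_add_natCast_eq h_cop hK
        (Set.nonempty_iff_ne_empty.mpr hne))).1 rfl
    exact ⟨Set.sUnion_eq_empty.mpr fun K hK => h_stable K hK.1 hK.2,
      Set.sUnion_eq_empty.mpr fun K hK => h_stable K hK.1 hK.2.1⟩
  refine ⟨⟨fun hAB => ?_, fun h => (h_empty h).1.trans (h_empty h).2.symm⟩, h_empty⟩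
  by_contra h
  have hd : Nat.gcd r s ∣ n := dvd_add (Nat.gcd_dvd_left r s) (Nat.gcd_dvd_right r s)
  have : Fact (1 < Nat.gcd r s) := ⟨by have := Nat.gcd_pos_of_pos_left s hr; omega⟩
  let f := ZMod.castHom hd (ZMod (Nat.gcd r s))
  have hfr : f (r : ZMod n) = 0 := by
    rw [map_natCast, ZMod.natCast_eq_zero_iff]
    exact Nat.gcd_dvd_left r s
  have hfs : f (s : ZMod n) = 0 := by
    rw [map_natCast, ZMod.natCast_eq_zero_iff]
    exact Nat.gcd_dvd_right r s
  have hA : (r : ZMod n) - s + 1 ∈ A := by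
    refine ⟨{l | f l ≠ 0}, ⟨fun l hl => ⟨?_, ?_⟩, f.image_add_setOf_ne_zero hfs⟩, ?_⟩
    · rintro rfl
      exact hl (map_zero f)
    · rintro rfl
      exact hl hfr
    · simp [hfr, hfs]
  rw [hAB] at hA
  obtain ⟨K, ⟨-, -, hKT⟩, hmem⟩ := hA
  exact Set.eq_empty_iff_forall_notMem.mp hKT _ ⟨hmem, by simp [T]⟩
end

section
/- For i ∈ ℤ/dℤ define C_i := {x ∈ ℤ/nℤ : for every N with 1 ≤ N ≤ d, x − T_i(N)‾ ∉ H}. Then: (a) C_i ⊆ I_i for every i; (b) C_i = {x + s̄_{i−1} : x ∈ C_{i−1}} for every i; and (c) for every family of subsets (K_i)_{i ∈ ℤ/dℤ} with K_i ⊆ I_i and K_i = {x + s̄_{i−1} : x ∈ K_{i−1}} for all i, one has K_i ⊆ C_i for all i. In other words, (C_i)_i is the largest family of subsets of the I_i stable under the componentwise translations by s̄_{i−1}. -/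
/-- The backward partial sum `s (i - 1) + s (i - 2) + ⋯ + s (i - N)`. -/
def backwardSum {d : ℕ} (s : ZMod d → ℕ) (i : ZMod d) (N : ℕ) : ℕ :=
  ∑ l ∈ Finset.Icc 1 N, s (i - (l : ZMod d))

section BackwardSum

variable {d : ℕ} (s : ZMod d → ℕ) (i : ZMod d)

@[simp]
lemma backwardSum_zero : backwardSum s i 0 = 0 := by
  simp [backwardSum]

lemma backwardSum_succ (N : ℕ) :
    backwardSum s i (N + 1) = backwardSum s i N + s (i - ((N + 1 : ℕ) : ZMod d)) := by
  simp only [backwardSum]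
  rw [Finset.sum_Icc_succ_top (by omega)]

lemma backwardSum_succ' (N : ℕ) :
    backwardSum s i (N + 1) = s (i - 1) + backwardSum s (i - 1) N := by
  induction N with
  | zero => simp [backwardSum_succ]
  | succ N ih =>
    rw [backwardSum_succ, ih, backwardSum_succ, add_assoc]
    congr 3
    push_cast
    ring

lemma sum_range_natCast_zmod {M : Type*} [AddCommMonoid M] [NeZero d] (f : ZMod d → M) :
    ∑ l ∈ Finset.range d, f (l : ZMod d) = ∑ z : ZMod d, f z := by
  refine Finset.sum_bij (fun l _ => (l : ZMod d)) (by simp) ?_ ?_ (by simp)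
  · intro a ha b hb h
    rw [Finset.mem_range] at ha hb
    rwa [ZMod.natCast_eq_natCast_iff', Nat.mod_eq_of_lt ha, Nat.mod_eq_of_lt hb] at h
  · intro z _
    exact ⟨z.val, Finset.mem_range.2 (ZMod.val_lt z), ZMod.natCast_zmod_val z⟩

lemma backwardSum_period [NeZero d] :
    backwardSum s i d = ∑ l ∈ Finset.range d, s (l : ZMod d) := by
  have h : backwardSum s i d = ∑ l ∈ Finset.range d, s (i - 1 - (l : ZMod d)) := by
    rw [backwardSum, Finset.range_eq_Ico, ← Finset.Ico_add_one_right_eq_Icc,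
      ← Finset.sum_Ico_add' (fun l : ℕ => s (i - (l : ZMod d))) 0 d 1]
    refine Finset.sum_congr rfl fun l _ => ?_
    congr 1
    push_cast
    ring
  rw [h, sum_range_natCast_zmod (fun z => s (i - 1 - z)), sum_range_natCast_zmod]
  exact Equiv.sum_comp (Equiv.subLeft (i - 1)) s

lemma backwardSum_add_period [NeZero d] (N : ℕ) :
    backwardSum s i (N + d) = backwardSum s i N + ∑ l ∈ Finset.range d, s (l : ZMod d) := by
  induction N with
  | zero => simp [backwardSum_period]
  | succ N ih =>
    rw [show N + 1 + d = (N + d) + 1 by ring, backwardSum_succ, ih, backwardSum_succ]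
    simp only [Nat.cast_add, CharP.cast_eq_zero, add_zero]
    ring

lemma backwardSum_add_mul_period [NeZero d] (N k : ℕ) :
    backwardSum s i (N + k * d) =
      backwardSum s i N + k * ∑ l ∈ Finset.range d, s (l : ZMod d) := by
  induction k with
  | zero => simp
  | succ k ih =>
    rw [show N + (k + 1) * d = (N + k * d) + d by ring, backwardSum_add_period, ih]
    ring

end BackwardSum

lemma zmultiples_natCast_gcd (S n : ℕ) :
    AddSubgroup.zmultiples ((Nat.gcd S n : ℕ) : ZMod n) =
      AddSubgroup.zmultiples (S : ZMod n) := by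
  apply le_antisymm
  · rw [AddSubgroup.zmultiples_le, AddSubgroup.mem_zmultiples_iff]
    refine ⟨Nat.gcdA S n, ?_⟩
    have h := congrArg (Int.cast : ℤ → ZMod n) (Nat.gcd_eq_gcd_ab S n)
    push_cast at h
    simp only [CharP.cast_eq_zero, zero_mul, add_zero] at h
    rw [h, zsmul_eq_mul, mul_comm]
  · rw [AddSubgroup.zmultiples_le]
    obtain ⟨c, hc⟩ := Nat.gcd_dvd_left S n
    refine AddSubgroup.mem_zmultiples_iff.2 ⟨c, ?_⟩
    conv_rhs => rw [hc]
    push_cast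
    rw [zsmul_eq_mul, mul_comm]
    simp

/-- Avoiding a subgroup containing the sum over a period along one period of backward sums is
the same as avoiding it along all of them. -/
lemma forall_period_sub_backwardSum_notMem {d n : ℕ} [NeZero d] (s : ZMod d → ℕ)
    {H : AddSubgroup (ZMod n)}
    (hS : ((∑ l ∈ Finset.range d, s (l : ZMod d) : ℕ) : ZMod n) ∈ H)
    (i : ZMod d) (x : ZMod n) :
    (∀ N : ℕ, 1 ≤ N → N ≤ d → x - (backwardSum s i N : ZMod n) ∉ H) ↔
      ∀ N : ℕ, x - (backwardSum s i N : ZMod n) ∉ H := by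
  refine ⟨fun h N => ?_, fun h N _ _ => h N⟩
  have hd := NeZero.pos d
  have shift : ∀ M, x - (backwardSum s i M : ZMod n) ∈ H →
      x - (backwardSum s i (M + d) : ZMod n) ∈ H := fun M hM => by
    rw [backwardSum_add_period, Nat.cast_add, ← sub_sub]
    exact H.sub_mem hM hS
  have shift' : ∀ M, x - (backwardSum s i (M + d) : ZMod n) ∈ H →
      x - (backwardSum s i M : ZMod n) ∈ H := fun M hM => by
    rw [backwardSum_add_period, Nat.cast_add, ← sub_sub] at hM
    simpa using H.add_mem hM hS
  induction N using Nat.strong_induction_on with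
  | _ N ih =>
    intro hN
    by_cases h0 : N = 0
    · subst h0
      exact h d hd le_rfl (by simpa only [zero_add] using shift 0 hN)
    by_cases hle : N ≤ d
    · exact h N (by omega) hle hN
    · refine ih (N - d) (by omega) (shift' _ ?_)
      rwa [Nat.sub_add_cancel (by omega)]


/-- Proposition `prop-canon0`: for the Weil restriction of `GL_n` along `𝔽_{p^d}/𝔽_p`
with signatures `(r_i, s_i)`, the family `C_i = {x : ∀ 1 ≤ N ≤ d, x - T_i(N) ∉ H}` is the
largest family of subsets `K_i ⊆ I_i = (ℤ/nℤ) \ {0, r_i}` with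
`K_i = K_{i-1} + s_{i-1}` for all `i`. -/
theorem weil_restriction_type_of_canonical_parabolic_of_identity
    (d n : ℕ) (hd : 1 ≤ d) (hn : 1 ≤ n) (s : ZMod d → ℕ) (hs : ∀ i, s i ≤ n) :
    let S : ℕ := ∑ l ∈ Finset.range d, s (l : ZMod d)
    let H : AddSubgroup (ZMod n) := AddSubgroup.zmultiples ((Nat.gcd S n : ℕ) : ZMod n)
    let T : ZMod d → ℕ → ℕ := fun i N => ∑ l ∈ Finset.Icc 1 N, s (i - (l : ZMod d))
    let I : ZMod d → Set (ZMod n) := fun i => {x | x ≠ 0 ∧ x ≠ ((n - s i : ℕ) : ZMod n)}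
    let C : ZMod d → Set (ZMod n) :=
      fun i => {x | ∀ N : ℕ, 1 ≤ N → N ≤ d → x - ((T i N : ℕ) : ZMod n) ∉ H}
    (∀ i, C i ⊆ I i) ∧
    (∀ i, C i = (fun x => x + ((s (i - 1) : ℕ) : ZMod n)) '' C (i - 1)) ∧
    (∀ Kf : ZMod d → Set (ZMod n),
      (∀ i, Kf i ⊆ I i) →
      (∀ i, Kf i = (fun x => x + ((s (i - 1) : ℕ) : ZMod n)) '' Kf (i - 1)) →
      ∀ i, Kf i ⊆ C i) := by
  intro S H T I C
  have : NeZero d := ⟨by omega⟩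
  have : NeZero n := ⟨by omega⟩
  have hH : H = AddSubgroup.zmultiples (S : ZMod n) := zmultiples_natCast_gcd S n
  have hS : (S : ZMod n) ∈ H := hH ▸ AddSubgroup.mem_zmultiples _
  have hC : ∀ i x, x ∈ C i ↔ ∀ N : ℕ, x - (backwardSum s i N : ZMod n) ∉ H :=
    forall_period_sub_backwardSum_notMem s hS
  refine ⟨fun i x hx => ⟨?_, ?_⟩, fun i => ?_, fun K hKI hK i x hx => ?_⟩
  · rintro rfl
    exact (hC i 0).1 hx 0 (by simp)
  · rintro rfl
    refine (hC i _).1 hx (d - 1) ?_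
    have h : S = backwardSum s i (d - 1) + s i := by
      have h := backwardSum_succ s i (d - 1)
      rwa [Nat.sub_add_cancel hd, backwardSum_period, CharP.cast_eq_zero, sub_zero] at h
    have h' : ((n - s i : ℕ) : ZMod n) - (backwardSum s i (d - 1) : ZMod n) = -(S : ZMod n) := by
      rw [h, Nat.cast_sub (hs i)]
      simp
      ring
    rw [h']
    exact H.neg_mem hS
  · ext x
    rw [Set.mem_image]
    have key : ∀ y N, y + (s (i - 1) : ZMod n) - (backwardSum s i (N + 1) : ZMod n) =
        y - (backwardSum s (i - 1) N : ZMod n) := fun y N => by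
      rw [backwardSum_succ']
      push_cast
      ring
    constructor
    · intro hx
      refine ⟨x - (s (i - 1) : ZMod n), (hC _ _).2 fun N => ?_, sub_add_cancel _ _⟩
      rw [← key, sub_add_cancel]
      exact (hC i x).1 hx (N + 1)
    · rintro ⟨y, hy, rfl⟩ N hN _
      obtain ⟨M, rfl⟩ := Nat.exists_eq_add_of_le' hN
      change y + (s (i - 1) : ZMod n) - (backwardSum s i (M + 1) : ZMod n) ∉ H
      rw [key]
      exact (hC _ y).1 hy M
  · have mem : ∀ N : ℕ, x - (backwardSum s i N : ZMod n) ∈ K (i - (N : ZMod d)) := by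
      intro N
      induction N with
      | zero => simpa using hx
      | succ N ih =>
        rw [hK] at ih
        obtain ⟨y, hy, hxy⟩ := ih
        have hi : i - ((N + 1 : ℕ) : ZMod d) = i - (N : ZMod d) - 1 := by
          push_cast
          ring
        rw [backwardSum_succ, hi, Nat.cast_add, ← sub_sub, ← hxy]
        simpa using hy
    refine (hC i x).2 fun N hN => ?_
    rw [hH, ← mem_multiples_iff_mem_zmultiples, AddSubmonoid.mem_multiples_iff] at hN
    obtain ⟨k, hk⟩ := hN
    refine (hKI _ (mem (N + k * d))).1 ?_
    rw [backwardSum_add_mul_period, Nat.cast_add, ← sub_sub, ← hk]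
    simp [S]
end

section
/- Fix j ∈ ℤ/dℤ with 1 ≤ r_j ≤ n − 1, and let (C_i)_i and (C'_i)_i be the explicit families defined above. The following are equivalent: (i) C'_i = C_i for all i ∈ ℤ/dℤ; (ii) C'_{j+1} = C_{j+1}; (iii) there exist N₁ and N₂ with 1 ≤ N₁, N₂ ≤ d such that 1̄ − T_{j+1}(N₁)‾ ∈ H and (−1)‾ − T_{j+1}(N₂)‾ ∈ H (that is, both 1 and −1 are congruent modulo δ to one of the partial sums Σ_{l=1}^{N} s_{j+1−l}, 1 ≤ N ≤ d). -/
theorem ZMod.sum_range_natCast {M : Type*} [AddCommMonoid M] (d : ℕ) [NeZero d]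
    (f : ZMod d → M) : ∑ l ∈ Finset.range d, f (l : ZMod d) = ∑ x, f x :=
  Finset.sum_bij (fun l _ => (l : ZMod d)) (fun _ _ => Finset.mem_univ _)
    (fun a ha b hb h => by
      rw [ZMod.natCast_eq_natCast_iff'] at h
      rwa [Nat.mod_eq_of_lt (Finset.mem_range.mp ha),
        Nat.mod_eq_of_lt (Finset.mem_range.mp hb)] at h)
    (fun x _ => ⟨x.val, Finset.mem_range.mpr x.val_lt, ZMod.natCast_zmod_val x⟩)
    (fun _ _ => rfl)

theorem Finset.sum_Icc_one_add {M : Type*} [AddCommMonoid M] (f : ℕ → M) (a b : ℕ) :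
    ∑ l ∈ Finset.Icc 1 (a + b), f l =
      ∑ l ∈ Finset.Icc 1 a, f l + ∑ l ∈ Finset.Icc 1 b, f (a + l) := by
  induction b with
  | zero => simp
  | succ b ih =>
    rw [← add_assoc, Finset.sum_Icc_succ_top (by omega), ih,
      Finset.sum_Icc_succ_top (by omega), add_assoc, add_assoc a b 1]

/-- A sum of `d` consecutive values, read backwards from any point of `ZMod d`, runs over the
whole of `ZMod d`. -/
theorem ZMod.sum_Icc_sub_natCast {M : Type*} [AddCommMonoid M] (d : ℕ) [NeZero d]
    (f : ZMod d → M) (i : ZMod d) :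
    ∑ l ∈ Finset.Icc 1 d, f (i - (l : ZMod d)) = ∑ l ∈ Finset.range d, f (l : ZMod d) := by
  have h : ∑ l ∈ Finset.Icc 1 d, f (i - (l : ZMod d)) =
      ∑ l ∈ Finset.range d, f (i - 1 - (l : ZMod d)) := by
    rw [Finset.range_eq_Ico, ← Finset.Ico_succ_right_eq_Icc]
    refine (Finset.sum_Ico_add' (fun l : ℕ => f (i - (l : ZMod d))) 0 d 1).symm.trans ?_
    refine Finset.sum_congr rfl fun l _ => ?_
    congr 1
    push_cast
    ring
  rw [h, ZMod.sum_range_natCast d (fun x => f (i - 1 - x)), ZMod.sum_range_natCast d f]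
  exact (Equiv.subLeft (i - 1)).sum_comp f


/-- Theorem `thm-smooth` (combinatorial core): with `C_i` and `C'_i` as in
Propositions `prop-canon0` and `prop-canon1`, the following are equivalent:
(i) `C'_i = C_i` for all `i`; (ii) `C'_{j+1} = C_{j+1}`; (iii) both `1` and `-1` are
congruent modulo `H` to a partial sum `T_{j+1}(N)` for some `1 ≤ N ≤ d`. -/
theorem weil_restriction_length_one_stratum_smooth_iff
    (d n : ℕ) (hd : 1 ≤ d) (hn : 1 ≤ n) (s : ZMod d → ℕ) (hs : ∀ i, s i ≤ n)
    (j : ZMod d) (hj1 : 1 ≤ n - s j) (hj2 : n - s j ≤ n - 1) :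
    let S : ℕ := ∑ l ∈ Finset.range d, s (l : ZMod d)
    let H : AddSubgroup (ZMod n) := AddSubgroup.zmultiples ((Nat.gcd S n : ℕ) : ZMod n)
    let T : ZMod d → ℕ → ℕ := fun i N => ∑ l ∈ Finset.Icc 1 N, s (i - (l : ZMod d))
    let C : ZMod d → Set (ZMod n) :=
      fun i => {x | ∀ N : ℕ, 1 ≤ N → N ≤ d → x - ((T i N : ℕ) : ZMod n) ∉ H}
    let u : ZMod d → ℕ := fun i => T i ((i - j - 1).val)
    let C' : ZMod d → Set (ZMod n) :=
      fun i => {x | x ∈ C i ∧ x - ((u i : ℕ) : ZMod n) - 1 ∉ H ∧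
        x - ((u i : ℕ) : ZMod n) + 1 ∉ H}
    ((∀ i, C' i = C i) ↔ (C' (j + 1) = C (j + 1))) ∧
    ((C' (j + 1) = C (j + 1)) ↔
      (∃ N₁ N₂ : ℕ, 1 ≤ N₁ ∧ N₁ ≤ d ∧ 1 ≤ N₂ ∧ N₂ ≤ d ∧
        (1 : ZMod n) - ((T (j + 1) N₁ : ℕ) : ZMod n) ∈ H ∧
        (-1 : ZMod n) - ((T (j + 1) N₂ : ℕ) : ZMod n) ∈ H)) := by
  intro S H T C u C'
  have : NeZero d := ⟨by omega⟩
  have T_add : ∀ i a b, T i (a + b) = T i a + T (i - (a : ZMod d)) b := fun i a b => by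
    simp only [T, Finset.sum_Icc_one_add, Nat.cast_add, sub_sub]
  have T_period : ∀ i, T i d = S := ZMod.sum_Icc_sub_natCast d s
  have S_mem : (S : ZMod n) ∈ H := by
    obtain ⟨k, hk⟩ := Nat.gcd_dvd_left S n
    refine AddSubgroup.mem_zmultiples_iff.mpr ⟨k, ?_⟩
    conv_rhs => rw [hk]
    push_cast
    rw [zsmul_eq_mul, Int.cast_natCast, mul_comm]
  have not_mem_C : ∀ i N x, 1 ≤ N → N ≤ 2 * d → x - ((T i N : ℕ) : ZMod n) ∈ H → x ∉ C i := by
    intro i N x h1 h2 hx hC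
    rcases le_or_gt N d with hN | hN
    · exact hC N h1 hN hx
    · refine hC (N - d) (by omega) (by omega) ?_
      have hT : T i N = S + T i (N - d) := by
        conv_lhs => rw [← Nat.add_sub_cancel' hN.le, T_add, T_period, ZMod.natCast_self, sub_zero]
      rw [hT] at hx
      push_cast at hx
      have := H.add_mem hx S_mem
      rwa [show x - ((S : ZMod n) + (T i (N - d) : ZMod n)) + S = x - (T i (N - d) : ZMod n) by
        ring] at this
  have key : ∀ (i : ZMod d) (N : ℕ) (e x : ZMod n), 1 ≤ N → N ≤ d →
      e - ((T (j + 1) N : ℕ) : ZMod n) ∈ H → x ∈ C i → x - ((u i : ℕ) : ZMod n) - e ∉ H := by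
    intro i N e x h1 h2 he hx hxe
    refine not_mem_C i ((i - j - 1).val + N) x (by omega)
      (by have := (i - j - 1).val_lt; omega) ?_ hx
    rw [T_add, ZMod.natCast_zmod_val, show i - (i - j - 1) = j + 1 by ring]
    push_cast
    have := H.add_mem hxe he
    rwa [sub_add_sub_cancel, sub_sub] at this
  have hu : u (j + 1) = 0 := by
    simp [u, T]
  have iii_i : (∃ N₁ N₂ : ℕ, 1 ≤ N₁ ∧ N₁ ≤ d ∧ 1 ≤ N₂ ∧ N₂ ≤ d ∧
        (1 : ZMod n) - ((T (j + 1) N₁ : ℕ) : ZMod n) ∈ H ∧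
        (-1 : ZMod n) - ((T (j + 1) N₂ : ℕ) : ZMod n) ∈ H) → ∀ i, C' i = C i := by
    rintro ⟨N₁, N₂, h1, h1d, h2, h2d, hp, hm⟩ i
    refine Set.Subset.antisymm (fun x hx => hx.1) fun x hx => ⟨hx, ?_, ?_⟩
    · exact key i N₁ 1 x h1 h1d hp hx
    · simpa using key i N₂ (-1) x h2 h2d hm hx
  have ii_iii : C' (j + 1) = C (j + 1) → ∃ N₁ N₂ : ℕ, 1 ≤ N₁ ∧ N₁ ≤ d ∧ 1 ≤ N₂ ∧ N₂ ≤ d ∧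
        (1 : ZMod n) - ((T (j + 1) N₁ : ℕ) : ZMod n) ∈ H ∧
        (-1 : ZMod n) - ((T (j + 1) N₂ : ℕ) : ZMod n) ∈ H := by
    intro h
    have hp : (1 : ZMod n) ∉ C (j + 1) := fun hx => by
      rw [← h] at hx
      exact hx.2.1 (by simp [hu])
    have hm : (-1 : ZMod n) ∉ C (j + 1) := fun hx => by
      rw [← h] at hx
      exact hx.2.2 (by simp [hu])
    simp only [C, Set.mem_ofPred_eq, not_forall, not_not] at hp hm
    obtain ⟨N₁, h1, h1d, hp⟩ := hp
    obtain ⟨N₂, h2, h2d, hm⟩ := hm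
    exact ⟨N₁, N₂, h1, h1d, h2, h2d, hp, hm⟩
  exact ⟨⟨fun h => h _, fun h => iii_i (ii_iii h)⟩, ⟨ii_iii, fun h => iii_i h _⟩⟩
end

section
/- Suppose d = 2, with data s_1, s_2 and r_i = n − s_i, δ = gcd(s_1 + s_2, n), and H ≤ ℤ/nℤ the subgroup generated by δ̄. The following are equivalent: (i) C_1 = ∅ and C_2 = ∅, where C_i = {x ∈ ℤ/nℤ : x ∉ H ∪ (s̄_{i−1} + H)} is the i-th member of the largest stable family; (ii) for each j ∈ ℤ/2ℤ, both 1̄ and −1̄ lie in H ∪ (s̄_j + H); (iii) δ = 1, or δ = 2 and both r_1 and r_2 are odd. -/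
/-- If `d ∣ n`, an integer lies in the subgroup of `ZMod n` generated by `d` iff `d` divides it. -/
theorem ZMod.intCast_mem_zmultiples_natCast_iff {n d : ℕ} (hd : d ∣ n) (m : ℤ) :
    (m : ZMod n) ∈ AddSubgroup.zmultiples (d : ZMod n) ↔ (d : ℤ) ∣ m := by
  rw [AddSubgroup.mem_zmultiples_iff]
  constructor
  · rintro ⟨k, hk⟩
    have h : ((k * d : ℤ) : ZMod n) = (m : ZMod n) := by
      rw [← hk]
      simp
    have h' := (Int.natCast_dvd_natCast.mpr hd).trans
      ((ZMod.intCast_eq_intCast_iff_dvd_sub _ _ _).mp h)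
    simpa using dvd_add h' (dvd_mul_left (d : ℤ) k)
  · rintro ⟨k, rfl⟩
    exact ⟨k, by simp [mul_comm]⟩

/-- Proposition at the end of §5.2.2 of the paper (case `d = 2`): with
`C_i = (ℤ/nℤ) \ (H ∪ (s_{i-1} + H))`, the following are equivalent:
(i) `C_1 = ∅` and `C_2 = ∅`; (ii) for each `j`, both `1` and `-1` lie in
`H ∪ (s_j + H)`; (iii) `δ = 1`, or `δ = 2` and both `r_1` and `r_2` are odd. -/
theorem weil_restriction_d2_length_one_strata_smooth_iff
    (n : ℕ) (hn : 1 ≤ n) (s : ZMod 2 → ℕ) (hs : ∀ i, s i ≤ n) :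
    let δ : ℕ := Nat.gcd (s 1 + s 2) n
    let H : AddSubgroup (ZMod n) := AddSubgroup.zmultiples ((δ : ℕ) : ZMod n)
    let C : ZMod 2 → Set (ZMod n) :=
      fun i => {x | x ∉ H ∧ x - ((s (i - 1) : ℕ) : ZMod n) ∉ H}
    ((C 1 = ∅ ∧ C 2 = ∅) ↔
      (∀ j : ZMod 2,
        ((1 : ZMod n) ∈ H ∨ (1 : ZMod n) - ((s j : ℕ) : ZMod n) ∈ H) ∧
        ((-1 : ZMod n) ∈ H ∨ (-1 : ZMod n) - ((s j : ℕ) : ZMod n) ∈ H))) ∧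
    ((∀ j : ZMod 2,
        ((1 : ZMod n) ∈ H ∨ (1 : ZMod n) - ((s j : ℕ) : ZMod n) ∈ H) ∧
        ((-1 : ZMod n) ∈ H ∨ (-1 : ZMod n) - ((s j : ℕ) : ZMod n) ∈ H)) ↔
      (δ = 1 ∨ (δ = 2 ∧ Odd (n - s 1) ∧ Odd (n - s 2)))) := by
  intro δ H C
  have hδn : δ ∣ n := Nat.gcd_dvd_right _ _
  have key (m : ℤ) : (m : ZMod n) ∈ H ↔ (δ : ℤ) ∣ m :=
    ZMod.intCast_mem_zmultiples_natCast_iff hδn m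
  have key_sub (m : ℤ) (j : ZMod 2) : (m : ZMod n) - (s j : ZMod n) ∈ H ↔ (δ : ℤ) ∣ m - s j := by
    rw [← key]
    simp
  have hC (i : ZMod 2) :
      C i = ∅ ↔ ∀ m : ℤ, (δ : ℤ) ∣ m ∨ (δ : ℤ) ∣ m - s (i - 1) := by
    simp only [C, Set.eq_empty_iff_forall_notMem, Set.mem_ofPred_eq, not_and_or, not_not]
    rw [ZMod.intCast_surjective.forall]
    simp only [key, key_sub]
  have hU (j : ZMod 2) :
      (((1 : ZMod n) ∈ H ∨ (1 : ZMod n) - (s j : ZMod n) ∈ H) ∧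
        ((-1 : ZMod n) ∈ H ∨ (-1 : ZMod n) - (s j : ZMod n) ∈ H)) ↔
      (((δ : ℤ) ∣ 1 ∨ (δ : ℤ) ∣ 1 - s j) ∧ ((δ : ℤ) ∣ -1 ∨ (δ : ℤ) ∣ -1 - s j)) := by
    simp only [← key, Int.cast_sub, Int.cast_neg, Int.cast_one, Int.cast_natCast]
  have empty_iff : C 1 = ∅ ∧ C 2 = ∅ ↔ ∀ j, C (j + 1) = ∅ :=
    ⟨fun h j => by fin_cases j; exacts [h.1, h.2], fun h => ⟨h 0, h 1⟩⟩
  have units_of_empty : C 1 = ∅ ∧ C 2 = ∅ → ∀ j,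
      (((δ : ℤ) ∣ 1 ∨ (δ : ℤ) ∣ 1 - s j) ∧ ((δ : ℤ) ∣ -1 ∨ (δ : ℤ) ∣ -1 - s j)) := by
    intro h j
    have h' := (hC _).mp (empty_iff.mp h j)
    rw [add_sub_cancel_right] at h'
    exact ⟨h' 1, h' (-1)⟩
  have gcd_of_units : (∀ j,
      (((δ : ℤ) ∣ 1 ∨ (δ : ℤ) ∣ 1 - s j) ∧ ((δ : ℤ) ∣ -1 ∨ (δ : ℤ) ∣ -1 - s j))) →
      (δ = 1 ∨ (δ = 2 ∧ Odd (n - s 1) ∧ Odd (n - s 2))) := by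
    intro h
    by_cases h1 : δ = 1
    · exact Or.inl h1
    have hnd : ¬ (δ : ℤ) ∣ 1 := fun hd => h1 (Nat.dvd_one.mp (by exact_mod_cast hd))
    simp only [dvd_neg, hnd, false_or] at h
    have hδ2 : δ ∣ 2 := by
      have := dvd_sub (h 1).1 (h 1).2
      ring_nf at this
      exact_mod_cast this
    have hδ : δ = 2 := ((Nat.dvd_prime Nat.prime_two).mp hδ2).resolve_left h1
    have hodd (j : ZMod 2) : Odd (n - s j) := by
      have hj := (h j).1
      have := hs j
      rw [hδ] at hj hδn
      rw [Nat.odd_iff]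
      omega
    exact Or.inr ⟨hδ, hodd 1, hodd 2⟩
  have empty_of_gcd : (δ = 1 ∨ (δ = 2 ∧ Odd (n - s 1) ∧ Odd (n - s 2))) → C 1 = ∅ ∧ C 2 = ∅ := by
    intro h
    refine empty_iff.mpr fun j => (hC _).mpr fun m => ?_
    rw [add_sub_cancel_right]
    rcases h with h | ⟨h, ho1, ho2⟩
    · simp [h]
    · have ho : Odd (n - s j) := by
        fin_cases j
        exacts [ho2, ho1]
      have := hs j
      rw [h] at hδn ⊢
      rw [Nat.odd_iff] at ho
      omega
  simp only [hU]
  exact ⟨⟨units_of_empty, fun h => empty_of_gcd (gcd_of_units h)⟩,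
    ⟨gcd_of_units, fun h => units_of_empty (empty_of_gcd h)⟩⟩
end

section
/- For every w ∈ W, the map γ' is a bijection from 𝓔_w onto E_w; that is, γ' : 𝓔_w → Φ⁺ is injective and its image is exactly the set E_w of positive roots α such that w·s_α ≤ w in the Bruhat order and ℓ(w·s_α) = ℓ(w) − 1. -/
namespace TypeBWeyl

/-- The standard basis vector `e_i` of `ℤ^{(ℕ)}` (indexed by `1 ≤ i ≤ n`). -/
def e (i : ℕ) : ℕ → ℤ := fun k => if k = i then 1 else 0

/-- The positive roots of type `B_n`:
`e_i - e_j` and `e_i + e_j` for `1 ≤ i < j ≤ n` and `e_i` for `1 ≤ i ≤ n`. -/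
def IsPosRoot (n : ℕ) (v : ℕ → ℤ) : Prop :=
  (∃ i j : ℕ, 1 ≤ i ∧ i < j ∧ j ≤ n ∧ v = e i - e j) ∨
  (∃ i j : ℕ, 1 ≤ i ∧ i < j ∧ j ≤ n ∧ v = e i + e j) ∨
  (∃ i : ℕ, 1 ≤ i ∧ i ≤ n ∧ v = e i)

open Classical in
/-- The reflection `s_α` attached to a positive root `α`, as a permutation of the
positions `{1, …, 2n+1}` (position `m` mirrors position `2n+2-m`):
`s_{e_i - e_j} = (i j)(2n+2-i, 2n+2-j)`, `s_{e_i + e_j} = (i, 2n+2-j)(j, 2n+2-i)`,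
`s_{e_i} = (i, 2n+2-i)`. -/
noncomputable def reflPerm (n : ℕ) (v : ℕ → ℤ) : Equiv.Perm ℕ :=
  if h : ∃ p : ℕ × ℕ, 1 ≤ p.1 ∧ p.1 < p.2 ∧ p.2 ≤ n ∧ v = e p.1 - e p.2 then
    Equiv.swap h.choose.1 h.choose.2 *
      Equiv.swap (2 * n + 2 - h.choose.1) (2 * n + 2 - h.choose.2)
  else if h : ∃ p : ℕ × ℕ, 1 ≤ p.1 ∧ p.1 < p.2 ∧ p.2 ≤ n ∧ v = e p.1 + e p.2 then
    Equiv.swap h.choose.1 (2 * n + 2 - h.choose.2) *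
      Equiv.swap h.choose.2 (2 * n + 2 - h.choose.1)
  else if h : ∃ i : ℕ, 1 ≤ i ∧ i ≤ n ∧ v = e i then
    Equiv.swap h.choose (2 * n + 2 - h.choose)
  else 1

/-- `M(w) = #{(i,j) : 1 ≤ i < j ≤ n, w(i) > w(j)}`. -/
def M (n : ℕ) (w : Equiv.Perm ℕ) : ℕ :=
  (((Finset.Icc 1 n) ×ˢ (Finset.Icc 1 n)).filter
    (fun p => p.1 < p.2 ∧ w p.2 < w p.1)).card

/-- `N(w) = #{(i,j) : 1 ≤ i ≤ j ≤ n, w(i) + w(j) > 2n+1}`. -/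
def N (n : ℕ) (w : Equiv.Perm ℕ) : ℕ :=
  (((Finset.Icc 1 n) ×ˢ (Finset.Icc 1 n)).filter
    (fun p => p.1 ≤ p.2 ∧ 2 * n + 1 < w p.1 + w p.2)).card

/-- The length `ℓ(w) = M(w) + N(w)`. -/
def len (n : ℕ) (w : Equiv.Perm ℕ) : ℕ := M n w + N n w

/-- `r_w(i,j) = #{k ≤ i : w(k) ≤ j}`. -/
def rmat (w : Equiv.Perm ℕ) (i j : ℕ) : ℕ :=
  ((Finset.Icc 1 i).filter (fun k => w k ≤ j)).card

/-- The Bruhat order: `w₁ ≤ w₂` iff `r_{w₁}(i,j) ≥ r_{w₂}(i,j)` for all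
`1 ≤ i, j ≤ 2n`. -/
def BruhatLE (n : ℕ) (w₁ w₂ : Equiv.Perm ℕ) : Prop :=
  ∀ i j : ℕ, 1 ≤ i → i ≤ 2 * n → 1 ≤ j → j ≤ 2 * n → rmat w₂ i j ≤ rmat w₁ i j

/-- A pair `(i,j)` with `1 ≤ i < j ≤ 2n+1` is admissible for `w` if `w(i) > w(j)` and
there is no `k` with `i < k < j`, `k ≠ n+1` and `w(j) < w(k) < w(i)`. -/
def Admissible (n : ℕ) (w : Equiv.Perm ℕ) (p : ℕ × ℕ) : Prop :=
  1 ≤ p.1 ∧ p.1 < p.2 ∧ p.2 ≤ 2 * n + 1 ∧ w p.2 < w p.1 ∧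
    ¬∃ k : ℕ, p.1 < k ∧ k < p.2 ∧ k ≠ n + 1 ∧ w p.2 < w k ∧ w k < w p.1

/-- The set `𝓔_w = 𝓔_w¹ ⊔ 𝓔_w² ⊔ 𝓔_w³` of the paper. -/
def Ecal (n : ℕ) (w : Equiv.Perm ℕ) : Set (ℕ × ℕ) :=
  {p | Admissible n w p ∧
    (p.2 ≤ n ∨
     (p.1 ≤ n ∧ n < p.2 ∧ w p.1 ≤ n ∧ w p.2 ≤ n) ∨
     (p.1 ≤ n ∧ p.2 = 2 * n + 2 - p.1))}

/-- The map `γ'` : `γ'(i,j) = e_i - e_j` on `𝓔_w¹`, `γ'(i,j) = e_i + e_{2n+2-j}` on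
`𝓔_w²`, and `γ'(i,j) = e_i` on `𝓔_w³`. -/
def gammaRoot (n : ℕ) (p : ℕ × ℕ) : ℕ → ℤ :=
  if p.2 ≤ n then e p.1 - e p.2
  else if p.2 = 2 * n + 2 - p.1 then e p.1
  else e p.1 + e (2 * n + 2 - p.2)

/-- The set `E_w` of positive roots `α` with `w·s_α ≤ w` (Bruhat order) and
`ℓ(w·s_α) = ℓ(w) - 1`. -/
def Eset (n : ℕ) (w : Equiv.Perm ℕ) : Set (ℕ → ℤ) :=
  {α | IsPosRoot n α ∧ BruhatLE n (w * reflPerm n α) w ∧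
    len n (w * reflPerm n α) + 1 = len n w}

/-- The positions `{1, …, 2n+1}` without the middle one. -/
def positions (n : ℕ) : Finset ℕ := (Finset.Icc 1 (2 * n + 1)).erase (n + 1)

/-- The number of inversions of `w` on the positions different from `n+1`. -/
def invCount (S : Finset ℕ) (w : Equiv.Perm ℕ) : ℕ :=
  ((S ×ˢ S).filter (fun p => p.1 < p.2 ∧ w p.2 < w p.1)).card

/-- The positions strictly between `i` and `j` whose value is strictly between
`w j` and `w i`. -/
def between (S : Finset ℕ) (w : Equiv.Perm ℕ) (i j : ℕ) : Finset ℕ :=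
  S.filter (fun k => i < k ∧ k < j ∧ w j < w k ∧ w k < w i)

/-- The number of positions `i ≤ n` with value larger than `n+1`. -/
def negCount (n : ℕ) (w : Equiv.Perm ℕ) : ℕ :=
  ∑ a ∈ Finset.Icc 1 n, if n + 1 < w a then 1 else 0

/-- The symmetry `w(i) + w(2n+2-i) = 2n+2` defining the Weyl group of type `B_n`. -/
def IsSymm (n : ℕ) (w : Equiv.Perm ℕ) : Prop :=
  ∀ i : ℕ, 1 ≤ i → i ≤ 2 * n + 1 → w i + w (2 * n + 2 - i) = 2 * n + 2

theorem mem_positions {n k : ℕ} : k ∈ positions n ↔ 1 ≤ k ∧ k ≤ 2 * n + 1 ∧ k ≠ n + 1 := by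
  simp only [positions, Finset.mem_erase, Finset.mem_Icc]; tauto

theorem invCount_mul_swap {S : Finset ℕ} {w : Equiv.Perm ℕ} {i j : ℕ} (hi : i ∈ S) (hj : j ∈ S)
    (hij : i < j) (hw : w j < w i) :
    invCount S w = invCount S (w * Equiv.swap i j) + 1 + 2 * (between S w i j).card := by
  set s := Equiv.swap i j with hs
  have hsk : ∀ k, s k = if k = i then j else if k = j then i else k := fun k =>
    Equiv.swap_apply_def i j k
  have hsS : ∀ k, k ∈ S → s k ∈ S := by
    intro k hk; rw [hsk]; split_ifs <;> assumption
  have hss : ∀ k, s (s k) = k := fun k => Equiv.swap_apply_self i j k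
  set A := (S ×ˢ S).filter (fun p : ℕ × ℕ => p.1 < p.2 ∧ w p.2 < w p.1) with hA
  set B := (S ×ˢ S).filter (fun p : ℕ × ℕ => s p.1 < s p.2 ∧ w p.2 < w p.1) with hB
  have hBcard : invCount S (w * s) = B.card := by
    refine Finset.card_nbij' (fun p => (s p.1, s p.2)) (fun p => (s p.1, s p.2)) ?_ ?_ ?_ ?_
    · rintro ⟨a, b⟩ h
      simp only [hB, Finset.mem_coe, Finset.mem_filter, Finset.mem_product] at h ⊢
      simp only [Equiv.Perm.mul_apply, hss] at h ⊢
      exact ⟨⟨hsS _ h.1.1, hsS _ h.1.2⟩, h.2⟩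
    · rintro ⟨a, b⟩ h
      simp only [hB, Finset.mem_coe, Finset.mem_filter, Finset.mem_product] at h ⊢
      simp only [Equiv.Perm.mul_apply, hss] at h ⊢
      exact ⟨⟨hsS _ h.1.1, hsS _ h.1.2⟩, h.2⟩
    · rintro ⟨a, b⟩ _; simp [hss]
    · rintro ⟨a, b⟩ _; simp [hss]
  set K := S.filter (fun k => i < k ∧ k < j) with hK
  have hAB : A \ B = insert (i, j) ((K.filter (fun k => w k < w i)).image (fun k => (i, k)) ∪
      (K.filter (fun k => w j < w k)).image (fun k => (k, j))) := by
    ext ⟨a, b⟩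
    simp only [hA, hB, hK, Finset.mem_sdiff, Finset.mem_filter, Finset.mem_product,
      Finset.mem_insert, Finset.mem_union, Finset.mem_image, Prod.mk.injEq, hsk]
    grind
  have hBA : B \ A = (K.filter (fun k => w i < w k)).image (fun k => (k, i)) ∪
      (K.filter (fun k => w k < w j)).image (fun k => (j, k)) := by
    ext ⟨a, b⟩
    simp only [hA, hB, hK, Finset.mem_sdiff, Finset.mem_filter, Finset.mem_product,
      Finset.mem_union, Finset.mem_image, Prod.mk.injEq, hsk]
    grind
  have cAB : (A \ B).card = (K.filter (fun k => w k < w i)).card +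
      (K.filter (fun k => w j < w k)).card + 1 := by
    rw [hAB, Finset.card_insert_of_notMem, Finset.card_union_of_disjoint,
      Finset.card_image_of_injective, Finset.card_image_of_injective]
    · intro x y h; simpa using h
    · intro x y h; simpa using h
    · rw [Finset.disjoint_left]
      rintro ⟨a, b⟩
      simp only [hK, Finset.mem_filter, Finset.mem_image, Prod.mk.injEq]
      grind
    · simp only [hK, Finset.mem_filter, Finset.mem_image, Finset.mem_union, Prod.mk.injEq]
      grind
  have cBA : (B \ A).card = (K.filter (fun k => w i < w k)).card +
      (K.filter (fun k => w k < w j)).card := by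
    rw [hBA, Finset.card_union_of_disjoint,
      Finset.card_image_of_injective, Finset.card_image_of_injective]
    · intro x y h; simpa using h
    · intro x y h; simpa using h
    · rw [Finset.disjoint_left]
      rintro ⟨a, b⟩
      simp only [hK, Finset.mem_filter, Finset.mem_image, Prod.mk.injEq]
      grind
  have hlow : (K.filter (fun k => w k < w i)).card = (K.filter (fun k => w k < w j)).card +
      (between S w i j).card := by
    rw [← Finset.card_union_of_disjoint]
    · congr 1
      ext k
      have := w.injective.eq_iff (a := k) (b := j)
      simp only [between, hK, Finset.mem_filter, Finset.mem_union]
      grind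
    · rw [Finset.disjoint_left]; simp only [between, hK, Finset.mem_filter]; grind
  have hhigh : (K.filter (fun k => w j < w k)).card = (K.filter (fun k => w i < w k)).card +
      (between S w i j).card := by
    rw [← Finset.card_union_of_disjoint]
    · congr 1
      ext k
      have := w.injective.eq_iff (a := k) (b := i)
      simp only [between, hK, Finset.mem_filter, Finset.mem_union]
      grind
    · rw [Finset.disjoint_left]; simp only [between, hK, Finset.mem_filter]; grind
  have h1 := Finset.card_sdiff_add_card_inter A B
  have h2 := Finset.card_sdiff_add_card_inter B A
  rw [Finset.inter_comm] at h2
  have h3 : invCount S w = A.card := rfl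
  omega

theorem rmat_le_rmat_mul_swap {w : Equiv.Perm ℕ} {i j : ℕ} (hi : 1 ≤ i)
    (hij : i < j) (hw : w j < w i) (a b : ℕ) :
    rmat w a b ≤ rmat (w * Equiv.swap i j) a b := by
  have hsk := Equiv.swap_apply_def i j
  by_cases ha : j ≤ a
  · refine Finset.card_le_card_of_injOn (Equiv.swap i j) ?_ (Equiv.injective _).injOn
    intro k hk
    simp only [Finset.mem_coe, Finset.mem_filter, Finset.mem_Icc] at hk ⊢
    rw [Equiv.Perm.mul_apply, Equiv.swap_apply_self]
    refine ⟨?_, hk.2⟩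
    rw [hsk]
    grind
  · refine Finset.card_le_card fun k hk => ?_
    simp only [Finset.mem_filter, Finset.mem_Icc, Equiv.Perm.mul_apply, hsk] at hk ⊢
    grind

theorem sum_positions (n : ℕ) (f : ℕ → ℕ) :
    ∑ a ∈ positions n, f a = ∑ a ∈ Finset.Icc 1 n, (f a + f (2 * n + 2 - a)) := by
  have h : positions n = Finset.Icc 1 n ∪ (Finset.Icc 1 n).image (fun a => 2 * n + 2 - a) := by
    ext k
    simp only [mem_positions, Finset.mem_union, Finset.mem_image, Finset.mem_Icc]
    constructor
    · intro hk
      by_cases h : k ≤ n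
      · left; omega
      · right; exact ⟨2 * n + 2 - k, by omega, by omega⟩
    · rintro (h | ⟨a, h, rfl⟩) <;> omega
  rw [h, Finset.sum_union, Finset.sum_image, Finset.sum_add_distrib]
  · intro x hx y hy hxy
    simp only [Finset.coe_Icc, Set.mem_Icc] at hx hy hxy
    omega
  · rw [Finset.disjoint_left]
    simp only [Finset.mem_image, Finset.mem_Icc]
    rintro a ha ⟨b, hb, rfl⟩
    omega

theorem two_mul_len {n : ℕ} {w : Equiv.Perm ℕ} (hw : IsSymm n w) :
    2 * len n w = invCount (positions n) w + negCount n w := by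
  set L := Finset.Icc 1 n with hL
  set f : ℕ → ℕ → ℕ := fun a b => if a < b ∧ w b < w a then 1 else 0 with hf
  set g : ℕ → ℕ → ℕ := fun a b => if a ≤ b ∧ 2 * n + 1 < w a + w b then 1 else 0 with hg
  have hM : M n w = ∑ a ∈ L, ∑ b ∈ L, f a b := by
    rw [M, Finset.card_filter, Finset.sum_product]
  have hN : N n w = ∑ a ∈ L, ∑ b ∈ L, g a b := by
    rw [N, Finset.card_filter, Finset.sum_product]
  have hI : invCount (positions n) w = ∑ a ∈ L, ∑ b ∈ L,
      (f a b + f a (2 * n + 2 - b) + (f (2 * n + 2 - a) b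
        + f (2 * n + 2 - a) (2 * n + 2 - b))) := by
    rw [invCount, Finset.card_filter, Finset.sum_product, sum_positions]
    refine Finset.sum_congr rfl fun a _ => ?_
    rw [sum_positions, sum_positions, ← Finset.sum_add_distrib]
  have hneg : negCount n w = ∑ a ∈ L, ∑ b ∈ L,
      if a = b then (if n + 1 < w a then 1 else 0) else 0 := by
    refine Finset.sum_congr rfl fun a ha => ?_
    rw [Finset.sum_ite_eq, if_pos ha]
  have hM' : M n w = ∑ a ∈ L, ∑ b ∈ L, f b a := by rw [hM, Finset.sum_comm]
  have hN' : N n w = ∑ a ∈ L, ∑ b ∈ L, g b a := by rw [hN, Finset.sum_comm]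
  have key : M n w + M n w + (N n w + N n w) = invCount (positions n) w + negCount n w := by
    nth_rewrite 1 [hM]
    nth_rewrite 1 [hM']
    nth_rewrite 1 [hN]
    rw [hN', hI, hneg]
    simp only [← Finset.sum_add_distrib]
    refine Finset.sum_congr rfl fun a ha => Finset.sum_congr rfl fun b hb => ?_
    rw [hL, Finset.mem_Icc] at ha hb
    have h1 := hw a (by omega) (by omega)
    have h2 := hw b (by omega) (by omega)
    have h3 : w a ≠ w (2 * n + 2 - b) := fun h => by have := w.injective h; omega
    have f1 : f a (2 * n + 2 - b) = if 2 * n + 1 < w a + w b then 1 else 0 :=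
      if_congr (by omega) rfl rfl
    have f2 : f (2 * n + 2 - a) b = 0 := if_neg (by omega)
    have f3 : f (2 * n + 2 - a) (2 * n + 2 - b) = f b a := if_congr (by omega) rfl rfl
    rw [f1, f2, f3]
    rcases lt_trichotomy a b with h | h | h
    · simp only [hf, hg, h, h.not_gt, h.le, h.not_ge, h.ne, add_comm (w b), true_and, false_and,
        if_false]
      omega
    · subst h
      simp only [hf, hg, le_refl, true_and]
      split_ifs <;> omega
    · simp only [hf, hg, h, h.not_gt, h.le, h.not_ge, h.ne', add_comm (w b), true_and, false_and,
        if_false]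
      omega
  rw [len]
  omega

theorem negCount_exchange {n : ℕ} {u w : Equiv.Perm ℕ} {T : Finset ℕ}
    (hT : T ⊆ Finset.Icc 1 n) (h : ∀ a ∈ Finset.Icc 1 n, a ∉ T → u a = w a) :
    negCount n u + ∑ a ∈ T, (if n + 1 < w a then 1 else 0) =
      negCount n w + ∑ a ∈ T, (if n + 1 < u a then 1 else 0) := by
  rw [negCount, negCount, ← Finset.sum_sdiff hT, ← Finset.sum_sdiff hT]
  have : ∑ a ∈ Finset.Icc 1 n \ T, (if n + 1 < u a then 1 else 0) =
      ∑ a ∈ Finset.Icc 1 n \ T, (if n + 1 < w a then 1 else 0) :=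
    Finset.sum_congr rfl fun a ha => by
      rw [Finset.mem_sdiff] at ha
      rw [h a ha.1 ha.2]
  omega

/-- The reflection exchanging the positions `i, j` and their mirrors. -/
def pairRefl (n i j : ℕ) : Equiv.Perm ℕ :=
  Equiv.swap i j * Equiv.swap (2 * n + 2 - j) (2 * n + 2 - i)

theorem pairRefl_apply {n i j : ℕ} (hi : i ∈ positions n) (hj : j ∈ positions n)
    (hij : i ≠ j) (hij' : j ≠ 2 * n + 2 - i) (k : ℕ) :
    pairRefl n i j k = if k = i then j else if k = j then i else
      if k = 2 * n + 2 - i then 2 * n + 2 - j else if k = 2 * n + 2 - j then 2 * n + 2 - i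
      else k := by
  rw [mem_positions] at hi hj
  simp only [pairRefl, Equiv.Perm.mul_apply, Equiv.swap_apply_def]
  grind

theorem isSymm_mul_pairRefl {n i j : ℕ} {w : Equiv.Perm ℕ} (hw : IsSymm n w)
    (hi : i ∈ positions n) (hj : j ∈ positions n)
    (hij : i ≠ j) (hij' : j ≠ 2 * n + 2 - i) : IsSymm n (w * pairRefl n i j) := by
  intro k hk hk'
  simp only [Equiv.Perm.mul_apply, pairRefl_apply hi hj hij hij']
  rw [mem_positions] at hi hj
  have h1 := hw i (by omega) (by omega)
  have h2 := hw j (by omega) (by omega)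
  have h3 := hw k (by omega) (by omega)
  grind

theorem isSymm_mul_swap {n i : ℕ} {w : Equiv.Perm ℕ} (hw : IsSymm n w)
    (hi : i ∈ positions n) : IsSymm n (w * Equiv.swap i (2 * n + 2 - i)) := by
  intro k hk hk'
  simp only [Equiv.Perm.mul_apply, Equiv.swap_apply_def]
  rw [mem_positions] at hi
  have h1 := hw i (by omega) (by omega)
  have h3 := hw k (by omega) (by omega)
  grind

theorem invCount_mul_pairRefl {n i j : ℕ} {w : Equiv.Perm ℕ} (hw : IsSymm n w)
    (hi : i ∈ positions n) (hj : j ∈ positions n)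
    (hij : i < j) (hij' : j ≠ 2 * n + 2 - i) (h : w j < w i) :
    invCount (positions n) w = invCount (positions n) (w * pairRefl n i j) + 2 +
      2 * (between (positions n) w i j).card +
      2 * (between (positions n) (w * Equiv.swap i j) (2 * n + 2 - j) (2 * n + 2 - i)).card := by
  have h1 := invCount_mul_swap hi hj hij h
  rw [mem_positions] at hi hj
  have hi' := hw i (by omega) (by omega)
  have hj' := hw j (by omega) (by omega)
  have h2 := invCount_mul_swap (S := positions n) (w := w * Equiv.swap i j)
    (i := 2 * n + 2 - j) (j := 2 * n + 2 - i) (mem_positions.2 (by omega))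
    (mem_positions.2 (by omega)) (by omega) (by
      simp only [Equiv.Perm.mul_apply]
      rw [Equiv.swap_apply_of_ne_of_ne, Equiv.swap_apply_of_ne_of_ne] <;> omega)
  rw [pairRefl, ← mul_assoc]
  omega

theorem bruhatLE_mul_pairRefl {n i j : ℕ} {w : Equiv.Perm ℕ} (hw : IsSymm n w)
    (hi : i ∈ positions n) (hj : j ∈ positions n)
    (hij : i < j) (hij' : j ≠ 2 * n + 2 - i) (h : w j < w i) :
    BruhatLE n (w * pairRefl n i j) w := by
  rw [mem_positions] at hi hj
  have hi' := hw i (by omega) (by omega)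
  have hj' := hw j (by omega) (by omega)
  intro a b _ _ _ _
  rw [pairRefl, ← mul_assoc]
  refine (rmat_le_rmat_mul_swap hi.1 hij h a b).trans
    (rmat_le_rmat_mul_swap (by omega) (by omega) ?_ a b)
  simp only [Equiv.Perm.mul_apply]
  rw [Equiv.swap_apply_of_ne_of_ne, Equiv.swap_apply_of_ne_of_ne] <;> omega

theorem between_mirror_eq_empty {n i j : ℕ} {w : Equiv.Perm ℕ} (hw : IsSymm n w)
    (hi : i ∈ positions n) (hj : j ∈ positions n)
    (hij : i < j) (hij' : j ≠ 2 * n + 2 - i) (h : w j < w i)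
    (hc : j ≤ n ∨ w i ≤ n ∨ n < w j) (he : between (positions n) w i j = ∅) :
    between (positions n) (w * Equiv.swap i j) (2 * n + 2 - j) (2 * n + 2 - i) = ∅ := by
  rw [Finset.eq_empty_iff_forall_notMem] at he ⊢
  intro k hk
  have hmid := hw (n + 1) (by omega) (by omega)
  rw [show 2 * n + 2 - (n + 1) = n + 1 by omega] at hmid
  have hjn : w j ≠ w (n + 1) := fun h => (mem_positions.1 hj).2.2 (w.injective h)
  rw [mem_positions] at hi hj
  simp only [between, Finset.mem_filter, mem_positions] at hk he
  simp only [Equiv.Perm.mul_apply] at hk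
  have hi' := hw i (by omega) (by omega)
  have hj' := hw j (by omega) (by omega)
  have hk' := hw k (by omega) (by omega)
  rw [Equiv.swap_apply_of_ne_of_ne (x := 2 * n + 2 - j) (by omega) (by omega),
    Equiv.swap_apply_of_ne_of_ne (x := 2 * n + 2 - i) (by omega) (by omega)] at hk
  by_cases hki : k = i
  · subst hki; rw [Equiv.swap_apply_left] at hk; omega
  by_cases hkj : k = j
  · subst hkj; rw [Equiv.swap_apply_right] at hk; omega
  rw [Equiv.swap_apply_of_ne_of_ne hki hkj] at hk
  exact he (2 * n + 2 - k) (by omega)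

theorem len_mul_pairRefl {n i j : ℕ} {w : Equiv.Perm ℕ} (hw : IsSymm n w)
    (hi : i ∈ positions n) (hj : j ∈ positions n)
    (hij : i < j) (hij' : j ≠ 2 * n + 2 - i) (h : w j < w i)
    (hc : j ≤ n ∨ (i ≤ n ∧ n < j)) :
    len n w = len n (w * pairRefl n i j) + 1 +
      (between (positions n) w i j).card +
      (between (positions n) (w * Equiv.swap i j) (2 * n + 2 - j) (2 * n + 2 - i)).card +
      (if n < j ∧ n < w i ∧ w j ≤ n then 1 else 0) := by
  have h1 := two_mul_len hw
  have h2 := two_mul_len (isSymm_mul_pairRefl hw hi hj hij.ne hij')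
  have h3 := invCount_mul_pairRefl hw hi hj hij hij' h
  have hmid := hw (n + 1) (by omega) (by omega)
  rw [show 2 * n + 2 - (n + 1) = n + 1 by omega] at hmid
  have hap := pairRefl_apply hi hj hij.ne hij'
  have hi0 := hi
  have hj0 := hj
  rw [mem_positions] at hi hj
  have hi' := hw i (by omega) (by omega)
  have hj' := hw j (by omega) (by omega)
  have hin : w i ≠ w (n + 1) := fun h => hi.2.2 (w.injective h)
  have hjn : w j ≠ w (n + 1) := fun h => hj.2.2 (w.injective h)
  rcases hc with hc | hc
  · have h4 := negCount_exchange (n := n) (u := w * pairRefl n i j) (w := w) (T := {i, j})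
      (by intro a; simp only [Finset.mem_insert, Finset.mem_singleton, Finset.mem_Icc]; omega)
      (by
        intro a ha hT
        simp only [Finset.mem_insert, Finset.mem_singleton, not_or, Finset.mem_Icc] at ha hT
        rw [Equiv.Perm.mul_apply, hap]
        grind)
    rw [Finset.sum_pair hij.ne, Finset.sum_pair hij.ne] at h4
    simp only [Equiv.Perm.mul_apply, hap, if_true, hij.ne', if_false] at h4
    rw [if_neg (by omega)]
    omega
  · have hne : i ≠ 2 * n + 2 - j := by omega
    have h4 := negCount_exchange (n := n) (u := w * pairRefl n i j) (w := w)
      (T := {i, 2 * n + 2 - j})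
      (by intro a; simp only [Finset.mem_insert, Finset.mem_singleton, Finset.mem_Icc]; omega)
      (by
        intro a ha hT
        simp only [Finset.mem_insert, Finset.mem_singleton, not_or, Finset.mem_Icc] at ha hT
        rw [Equiv.Perm.mul_apply, hap]
        grind)
    rw [Finset.sum_pair hne, Finset.sum_pair hne] at h4
    have e1 : (w * pairRefl n i j) i = w j := by rw [Equiv.Perm.mul_apply, hap]; simp
    have e2 : (w * pairRefl n i j) (2 * n + 2 - j) = w (2 * n + 2 - i) := by
      rw [Equiv.Perm.mul_apply, hap]; grind
    rw [e1, e2] at h4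
    split_ifs at h4 ⊢ <;> omega

theorem len_mul_swap {n i : ℕ} {w : Equiv.Perm ℕ} (hw : IsSymm n w)
    (hi : 1 ≤ i) (hin : i ≤ n) (h : w (2 * n + 2 - i) < w i) :
    len n w = len n (w * Equiv.swap i (2 * n + 2 - i)) + 1 +
      (between (positions n) w i (2 * n + 2 - i)).card := by
  have hi0 : i ∈ positions n := mem_positions.2 (by omega)
  have h1 := two_mul_len hw
  have h2 := two_mul_len (isSymm_mul_swap hw hi0)
  have h3 := invCount_mul_swap hi0 (j := 2 * n + 2 - i) (mem_positions.2 (by omega))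
    (by omega) h
  have hi' := hw i (by omega) (by omega)
  have h4 := negCount_exchange (n := n) (u := w * Equiv.swap i (2 * n + 2 - i)) (w := w)
    (T := {i})
    (by intro a; simp only [Finset.mem_singleton, Finset.mem_Icc]; omega)
    (by
      intro a ha hT
      simp only [Finset.mem_singleton, Finset.mem_Icc] at ha hT
      rw [Equiv.Perm.mul_apply, Equiv.swap_apply_of_ne_of_ne] <;> omega)
  rw [Finset.sum_singleton, Finset.sum_singleton, Equiv.Perm.mul_apply,
    Equiv.swap_apply_left] at h4
  split_ifs at h4 <;> omega

theorem e_sub_e_inj {i j a b : ℕ} (hij : i ≠ j) (h : e i - e j = e a - e b) :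
    i = a ∧ j = b := by
  have h1 := congrFun h i
  have h2 := congrFun h j
  simp only [e, Pi.sub_apply] at h1 h2
  grind

theorem e_add_e_inj {i j a b : ℕ} (hij : i ≠ j) (h : e i + e j = e a + e b) :
    (i = a ∧ j = b) ∨ (i = b ∧ j = a) := by
  have h1 := congrFun h i
  have h2 := congrFun h j
  simp only [e, Pi.add_apply] at h1 h2
  grind

theorem e_inj {i a : ℕ} (h : e i = e a) : i = a := by
  have h1 := congrFun h i
  simp only [e] at h1
  grind

theorem e_sub_e_ne_e_add_e {i j a b : ℕ} (hij : i ≠ j) : e i - e j ≠ e a + e b := by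
  intro h
  have h2 := congrFun h j
  simp only [e, Pi.add_apply, Pi.sub_apply] at h2
  grind

theorem e_sub_e_ne_e {i j a : ℕ} (hij : i ≠ j) : e i - e j ≠ e a := by
  intro h
  have h2 := congrFun h j
  simp only [e, Pi.sub_apply] at h2
  grind

theorem e_add_e_ne_e {i j a : ℕ} (hij : i ≠ j) : e i + e j ≠ e a := by
  intro h
  have h1 := congrFun h i
  have h2 := congrFun h j
  simp only [e, Pi.add_apply] at h1 h2
  grind

theorem reflPerm_sub {n i j : ℕ} (hi : 1 ≤ i) (hij : i < j) (hj : j ≤ n) :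
    reflPerm n (e i - e j) = pairRefl n i j := by
  have h : ∃ p : ℕ × ℕ, 1 ≤ p.1 ∧ p.1 < p.2 ∧ p.2 ≤ n ∧ e i - e j = e p.1 - e p.2 :=
    ⟨(i, j), hi, hij, hj, rfl⟩
  rw [reflPerm, dif_pos h]
  obtain ⟨h1, h2⟩ := e_sub_e_inj hij.ne h.choose_spec.2.2.2
  rw [← h1, ← h2, pairRefl, Equiv.swap_comm (2 * n + 2 - i)]

theorem reflPerm_add_of_lt {n i j : ℕ} (hi : 1 ≤ i) (hij : i < j) (hj : j ≤ n) :
    reflPerm n (e i + e j) = Equiv.swap i (2 * n + 2 - j) * Equiv.swap j (2 * n + 2 - i) := by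
  have h : ∃ p : ℕ × ℕ, 1 ≤ p.1 ∧ p.1 < p.2 ∧ p.2 ≤ n ∧ e i + e j = e p.1 + e p.2 :=
    ⟨(i, j), hi, hij, hj, rfl⟩
  rw [reflPerm, dif_neg, dif_pos h]
  · have h1 := h.choose_spec.2.1
    have h2 : i = h.choose.1 ∧ j = h.choose.2 := by
      rcases e_add_e_inj hij.ne h.choose_spec.2.2.2 with h | h <;> omega
    rw [← h2.1, ← h2.2]
  · rintro ⟨p, -, hp, -, h⟩
    exact e_sub_e_ne_e_add_e hp.ne h.symm

theorem reflPerm_add {n i j : ℕ} (hi : 1 ≤ i) (hin : i ≤ n) (hj : 1 ≤ j) (hjn : j ≤ n)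
    (hij : i ≠ j) : reflPerm n (e i + e j) = pairRefl n i (2 * n + 2 - j) := by
  have hb : 2 * n + 2 - (2 * n + 2 - j) = j := by omega
  rcases lt_or_gt_of_ne hij with h | h
  · rw [reflPerm_add_of_lt hi h hjn, pairRefl, hb]
  · rw [add_comm, reflPerm_add_of_lt hj h hin, pairRefl, hb]
    refine (Equiv.Perm.disjoint_iff_eq_or_eq.2 fun k => ?_).commute.eq
    simp only [Equiv.swap_apply_def]
    grind

theorem reflPerm_single {n i : ℕ} (hi : 1 ≤ i) (hin : i ≤ n) :
    reflPerm n (e i) = Equiv.swap i (2 * n + 2 - i) := by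
  have h : ∃ a : ℕ, 1 ≤ a ∧ a ≤ n ∧ e i = e a := ⟨i, hi, hin, rfl⟩
  rw [reflPerm, dif_neg, dif_neg, dif_pos h]
  · rw [← e_inj h.choose_spec.2.2]
  · rintro ⟨p, -, hp, -, h⟩
    exact e_add_e_ne_e hp.ne h.symm
  · rintro ⟨p, -, hp, -, h⟩
    exact e_sub_e_ne_e hp.ne h.symm

theorem admissible_iff_between {n i j : ℕ} {w : Equiv.Perm ℕ} (hi : 1 ≤ i) (hij : i < j)
    (hj : j ≤ 2 * n + 1) (h : w j < w i) :
    Admissible n w (i, j) ↔ (between (positions n) w i j).card = 0 := by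
  rw [Finset.card_eq_zero, Finset.eq_empty_iff_forall_notMem]
  simp only [Admissible, between, Finset.mem_filter, mem_positions, not_exists]
  constructor
  · rintro ⟨-, -, -, -, h⟩ k hk
    exact h k (by tauto)
  · exact fun h' => ⟨hi, hij, hj, h, fun k hk => h' k ⟨by omega, by tauto⟩⟩

/-- Membership in the set of lower covers for the reflection in a pair of positions `i < j`
that are not mirror images. -/
theorem cover_pairRefl_iff {n i j : ℕ} {w : Equiv.Perm ℕ} (hw : IsSymm n w)
    (hi : i ∈ positions n) (hj : j ∈ positions n)
    (hij : i < j) (hij' : j ≠ 2 * n + 2 - i) (hc : j ≤ n ∨ (i ≤ n ∧ n < j)) :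
    (BruhatLE n (w * pairRefl n i j) w ∧ len n (w * pairRefl n i j) + 1 = len n w) ↔
      Admissible n w (i, j) ∧ (j ≤ n ∨ w i ≤ n ∨ n < w j) := by
  have hip := mem_positions.1 hi
  have hjp := mem_positions.1 hj
  by_cases h : w j < w i
  · have hlen := len_mul_pairRefl hw hi hj hij hij' h hc
    rw [admissible_iff_between hip.1 hij hjp.2.1 h]
    constructor
    · rintro ⟨-, hl⟩
      split_ifs at hlen <;> omega
    · rintro ⟨hA, hv⟩
      refine ⟨bruhatLE_mul_pairRefl hw hi hj hij hij' h, ?_⟩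
      have hB : (between (positions n) (w * Equiv.swap i j)
          (2 * n + 2 - j) (2 * n + 2 - i)).card = 0 :=
        Finset.card_eq_zero.2
          (between_mirror_eq_empty hw hi hj hij hij' h hv (Finset.card_eq_zero.1 hA))
      rw [if_neg (by omega)] at hlen
      omega
  · have hlt : w i < w j :=
      lt_of_le_of_ne (not_lt.1 h) fun h' => hij.ne (w.injective h')
    refine iff_of_false ?_ fun h' => h h'.1.2.2.2.1
    rintro ⟨-, hl⟩
    have hap := pairRefl_apply hi hj hij.ne hij'
    have h1 : (w * pairRefl n i j) i = w j := by rw [Equiv.Perm.mul_apply, hap]; simp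
    have h2 : (w * pairRefl n i j) j = w i := by
      rw [Equiv.Perm.mul_apply, hap]; simp [hij.ne']
    have hlen := len_mul_pairRefl (isSymm_mul_pairRefl hw hi hj hij.ne hij') hi hj hij hij'
      (by rw [h1, h2]; exact hlt) hc
    have hinv : w * pairRefl n i j * pairRefl n i j = w := by
      ext k
      simp only [Equiv.Perm.mul_apply, hap]
      grind
    rw [hinv] at hlen
    omega

/-- Membership in the set of lower covers for the reflection in a short root. -/
theorem cover_swap_iff {n i : ℕ} {w : Equiv.Perm ℕ} (hw : IsSymm n w)
    (hi : 1 ≤ i) (hin : i ≤ n) :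
    (BruhatLE n (w * Equiv.swap i (2 * n + 2 - i)) w ∧
      len n (w * Equiv.swap i (2 * n + 2 - i)) + 1 = len n w) ↔
      Admissible n w (i, 2 * n + 2 - i) := by
  have hi0 : i ∈ positions n := mem_positions.2 (by omega)
  by_cases h : w (2 * n + 2 - i) < w i
  · have hlen := len_mul_swap hw hi hin h
    rw [admissible_iff_between hi (by omega) (by omega) h]
    constructor
    · rintro ⟨-, hl⟩; omega
    · exact fun hA => ⟨fun a b _ _ _ _ => rmat_le_rmat_mul_swap hi (by omega) h a b, by omega⟩
  · have hlt : w i < w (2 * n + 2 - i) :=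
      lt_of_le_of_ne (not_lt.1 h) fun h' => by have := w.injective h'; omega
    refine iff_of_false ?_ fun h' => h h'.2.2.2.1
    rintro ⟨-, hl⟩
    have hlen := len_mul_swap (isSymm_mul_swap hw hi0) hi hin
      (by simpa [Equiv.Perm.mul_apply] using hlt)
    rw [mul_assoc, Equiv.swap_mul_self, mul_one] at hlen
    omega

theorem sub_mem_Eset_iff {n i j : ℕ} {w : Equiv.Perm ℕ} (hw : IsSymm n w)
    (hi : 1 ≤ i) (hij : i < j) (hj : j ≤ n) :
    e i - e j ∈ Eset n w ↔ Admissible n w (i, j) := by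
  have hroot : IsPosRoot n (e i - e j) := Or.inl ⟨i, j, hi, hij, hj, rfl⟩
  have := cover_pairRefl_iff hw (i := i) (j := j) (mem_positions.2 (by omega))
    (mem_positions.2 (by omega)) hij (by omega) (Or.inl hj)
  rw [Eset, Set.mem_ofPred_eq, reflPerm_sub hi hij hj]
  tauto

theorem add_mem_Eset_iff {n i j : ℕ} {w : Equiv.Perm ℕ} (hw : IsSymm n w)
    (hi : 1 ≤ i) (hin : i ≤ n) (hj : 1 ≤ j) (hjn : j ≤ n) (hij : i ≠ j) :
    e i + e j ∈ Eset n w ↔ Admissible n w (i, 2 * n + 2 - j) ∧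
      (w i ≤ n ∨ n < w (2 * n + 2 - j)) := by
  have hroot : IsPosRoot n (e i + e j) := by
    rcases lt_or_gt_of_ne hij with h | h
    · exact Or.inr (Or.inl ⟨i, j, hi, h, hjn, rfl⟩)
    · exact Or.inr (Or.inl ⟨j, i, hj, h, hin, add_comm _ _⟩)
  have := cover_pairRefl_iff hw (i := i) (j := 2 * n + 2 - j) (mem_positions.2 (by omega))
    (mem_positions.2 (by omega)) (by omega) (by omega) (Or.inr (by omega))
  rw [Eset, Set.mem_ofPred_eq, reflPerm_add hi hin hj hjn hij]
  have h' : ¬ 2 * n + 2 - j ≤ n := by omega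
  tauto

theorem single_mem_Eset_iff {n i : ℕ} {w : Equiv.Perm ℕ} (hw : IsSymm n w)
    (hi : 1 ≤ i) (hin : i ≤ n) :
    e i ∈ Eset n w ↔ Admissible n w (i, 2 * n + 2 - i) := by
  have hroot : IsPosRoot n (e i) := Or.inr (Or.inr ⟨i, hi, hin, rfl⟩)
  have := cover_swap_iff hw hi hin
  rw [Eset, Set.mem_ofPred_eq, reflPerm_single hi hin]
  tauto

/-- The three kinds of pairs in `Ecal n w`, with the values of `gammaRoot`. -/
theorem Ecal_cases {n i j : ℕ} {w : Equiv.Perm ℕ} (hw : IsSymm n w) (h : (i, j) ∈ Ecal n w) :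
    (1 ≤ i ∧ i < j ∧ j ≤ n ∧ gammaRoot n (i, j) = e i - e j) ∨
    (∃ k, 1 ≤ i ∧ i ≤ n ∧ 1 ≤ k ∧ k ≤ n ∧ i ≠ k ∧ j = 2 * n + 2 - k ∧ w i ≤ n ∧ n + 1 < w k ∧
      gammaRoot n (i, j) = e i + e k) ∨
    (1 ≤ i ∧ i ≤ n ∧ j = 2 * n + 2 - i ∧ gammaRoot n (i, j) = e i) := by
  obtain ⟨⟨hi, hij, hj, -, -⟩, h⟩ := h
  dsimp only at hi hij hj h
  rcases h with h | ⟨hin, hjn, hwi, hwj⟩ | ⟨hin, rfl⟩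
  · exact Or.inl ⟨hi, hij, h, if_pos h⟩
  · have hmid := hw (n + 1) (by omega) (by omega)
    rw [show 2 * n + 2 - (n + 1) = n + 1 by omega] at hmid
    have hjm : j ≠ n + 1 := by rintro rfl; omega
    have hi' := hw i (by omega) (by omega)
    have hj' := hw j (by omega) (by omega)
    have hne : j ≠ 2 * n + 2 - i := by rintro rfl; omega
    refine Or.inr (Or.inl ⟨2 * n + 2 - j, hi, hin, by omega, by omega, by omega, by omega, hwi,
      by omega, ?_⟩)
    rw [gammaRoot, if_neg (by dsimp only; omega), if_neg hne]
  · refine Or.inr (Or.inr ⟨hi, hin, rfl, ?_⟩)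
    rw [gammaRoot, if_neg (by dsimp only; omega), if_pos rfl]

/-- Proposition `prop-Ew`: for every `w` in the Weyl group of type `B_n` (realized as
the permutations of `{1, …, 2n+1}` with `w(i) + w(2n+2-i) = 2n+2`), the map `γ'` is a
bijection from `𝓔_w` onto `E_w`. -/
theorem gammaRoot_bijOn_Eset (n : ℕ) (hn : 1 ≤ n) (w : Equiv.Perm ℕ)
    (hw : ∀ i : ℕ, 1 ≤ i → i ≤ 2 * n + 1 → w i + w (2 * n + 2 - i) = 2 * n + 2)
    (hw' : ∀ i : ℕ, i = 0 ∨ 2 * n + 1 < i → w i = i) :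
    Set.InjOn (gammaRoot n) (Ecal n w) ∧ gammaRoot n '' Ecal n w = Eset n w := by
  have hs : IsSymm n w := hw
  refine ⟨?_, ?_⟩
  · rintro ⟨i, j⟩ hp ⟨a, b⟩ hq h
    rcases Ecal_cases hs hp with ⟨_, hij, _, h1⟩ | ⟨k, _, _, _, _, hik, rfl, hwi, hwk, h1⟩ |
        ⟨_, _, rfl, h1⟩ <;>
      rcases Ecal_cases hs hq with ⟨_, hab, _, h2⟩ | ⟨c, _, _, _, _, hac, rfl, hwa, hwc, h2⟩ |
        ⟨_, _, rfl, h2⟩ <;>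
      rw [h1, h2] at h
    · obtain ⟨rfl, rfl⟩ := e_sub_e_inj hij.ne h; rfl
    · exact absurd h (e_sub_e_ne_e_add_e hij.ne)
    · exact absurd h (e_sub_e_ne_e hij.ne)
    · exact absurd h.symm (e_sub_e_ne_e_add_e hab.ne)
    · rcases e_add_e_inj hik h with ⟨rfl, rfl⟩ | ⟨rfl, rfl⟩
      · rfl
      · omega
    · exact absurd h (e_add_e_ne_e hik)
    · exact absurd h.symm (e_sub_e_ne_e hab.ne)
    · exact absurd h.symm (e_add_e_ne_e hac)
    · obtain rfl := e_inj h; rfl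
  · ext α
    constructor
    · rintro ⟨⟨i, j⟩, hp, rfl⟩
      have hA : Admissible n w (i, j) := hp.1
      rcases Ecal_cases hs hp with ⟨hi, hij, hj, h⟩ | ⟨k, hi, hin, hk, hkn, hik, rfl, hwi, -, h⟩ |
        ⟨hi, hin, rfl, h⟩ <;> rw [h]
      · exact (sub_mem_Eset_iff hs hi hij hj).2 hA
      · exact (add_mem_Eset_iff hs hi hin hk hkn hik).2 ⟨hA, Or.inl hwi⟩
      · exact (single_mem_Eset_iff hs hi hin).2 hA
    · intro hα
      have add_mem_image : ∀ i j, 1 ≤ i → i ≤ n → 1 ≤ j → j ≤ n → i ≠ j → w i ≤ n →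
          e i + e j ∈ Eset n w → e i + e j ∈ gammaRoot n '' Ecal n w := by
        intro i j hi hin hj hjn hij hwi hα
        have hA := ((add_mem_Eset_iff hs hi hin hj hjn hij).1 hα).1
        refine ⟨(i, 2 * n + 2 - j),
          ⟨hA, Or.inr (Or.inl ⟨hin, ?_, hwi, hA.2.2.2.1.le.trans hwi⟩)⟩, ?_⟩
        · dsimp only; omega
        · rw [gammaRoot, if_neg (by dsimp only; omega), if_neg (by dsimp only; omega),
            show 2 * n + 2 - (2 * n + 2 - j) = j by omega]
      rcases hα.1 with ⟨i, j, hi, hij, hj, rfl⟩ | ⟨i, j, hi, hij, hj, rfl⟩ | ⟨i, hi, hin, rfl⟩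
      · exact ⟨(i, j), ⟨(sub_mem_Eset_iff hs hi hij hj).1 hα, Or.inl hj⟩, if_pos hj⟩
      · have hj1 : 1 ≤ j := by omega
        have hin : i ≤ n := by omega
        by_cases hwi : w i ≤ n
        · exact add_mem_image i j hi hin hj1 hj hij.ne hwi hα
        · have hwj := (((add_mem_Eset_iff hs hi hin hj1 hj hij.ne).1 hα).2).resolve_left hwi
          have hmid := hw (n + 1) (by omega) (by omega)
          rw [show 2 * n + 2 - (n + 1) = n + 1 by omega] at hmid
          have hjn : w j ≠ w (n + 1) := fun h => by have := w.injective h; omega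
          have hj' := hw j hj1 (by omega)
          rw [add_comm] at hα ⊢
          exact add_mem_image j i hj1 hj hi hin hij.ne' (by omega) hα
      · refine ⟨(i, 2 * n + 2 - i), ⟨(single_mem_Eset_iff hs hi hin).1 hα,
          Or.inr (Or.inr ⟨hin, rfl⟩)⟩, ?_⟩
        rw [gammaRoot, if_neg (by dsimp only; omega), if_pos rfl]

end TypeBWeyl
end
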